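/- The function V : (0,2] → ℝ defined by V(r) = (1+t)⁵ + (t+1)²(t−1/3)²(t+1/3)²(t²−5/9)² / (6(1−t)²), where t = 1 − r²/2, is strictly decreasing and strictly convex on (0,2]. -/

import Mathlib

/-- The potential of Theorem 3 (the dodecahedron theorem), as a function of the inner
product `t = 1 - r²/2`. -/
noncomputable def dodecW : ℝ → ℝ := fun t =>
  (1 + t) ^ 5 +
    (t + 1) ^ 2 * (t - 1 / 3) ^ 2 * (t + 1 / 3) ^ 2 * (t ^ 2 - 5 / 9) ^ 2 /
      (6 * (1 - t) ^ 2)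

/-- The potential of Theorem 3 (the dodecahedron theorem). -/
noncomputable def dodecV : ℝ → ℝ := fun r => dodecW (1 - r ^ 2 / 2)

/-- The numerator of the second derivative of `dodecV` in the variable `s = r² / 2`, homogenized
by `h` and scaled to have integer coefficients. -/
noncomputable def dodecNumerator (h s : ℝ) : ℝ :=
  40960 * h ^ 10 - 178176 * h ^ 9 * s - 4289760 * h ^ 7 * s ^ 3 +
    32280768 * h ^ 6 * s ^ 4 - 65532240 * h ^ 5 * s ^ 5 + 75179664 * h ^ 4 * s ^ 6 -
    56883870 * h ^ 3 * s ^ 7 + 27136296 * h ^ 2 * s ^ 8 - 7164612 * h * s ^ 9 +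
    787320 * s ^ 10

theorem dodecNumerator_mul (c h s : ℝ) :
    dodecNumerator (c * h) (c * s) = c ^ 10 * dodecNumerator h s := by
  unfold dodecNumerator
  ring

/-- Positivity on `[a, b)` follows from positivity on the cone spanned by the endpoints. -/
theorem dodecNumerator_pos_of_cone {a b : ℝ}
    (H : ∀ u v : ℝ, 0 ≤ u → 0 < v → 0 < dodecNumerator (u + v) (a * v + b * u))
    {s : ℝ} (ha : a ≤ s) (hb : s < b) : 0 < dodecNumerator 1 s := by
  have key := H (s - a) (b - s) (sub_nonneg.2 ha) (sub_pos.2 hb)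
  have e : dodecNumerator (s - a + (b - s)) (a * (b - s) + b * (s - a)) =
      (b - a) ^ 10 * dodecNumerator 1 s := by
    rw [← dodecNumerator_mul]
    congr 1 <;> ring
  rw [e] at key
  exact pos_of_mul_pos_right key (by positivity)

theorem dodecNumerator_pos {s : ℝ} (h0 : 0 ≤ s) (h2 : s < 2) : 0 < dodecNumerator 1 s := by
  rcases lt_or_ge s (1 / 4) with hs | h
  · exact dodecNumerator_pos_of_cone (a := 0) (b := 1 / 4) (fun u v hu hv => by
        unfold dodecNumerator
        ring_nf
        positivity) h0 hs
  rcases lt_or_ge s (1 / 2) with hs | h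
  · exact dodecNumerator_pos_of_cone (a := 1 / 4) (b := 1 / 2) (fun u v hu hv => by
        unfold dodecNumerator
        ring_nf
        positivity) h hs
  rcases lt_or_ge s 1 with hs | h
  · exact dodecNumerator_pos_of_cone (a := 1 / 2) (b := 1) (fun u v hu hv => by
        unfold dodecNumerator
        ring_nf
        positivity) h hs
  rcases lt_or_ge s (3 / 2) with hs | h
  · exact dodecNumerator_pos_of_cone (a := 1) (b := 3 / 2) (fun u v hu hv => by
        unfold dodecNumerator
        ring_nf
        positivity) h hs
  rcases lt_or_ge s (7 / 4) with hs | h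
  · exact dodecNumerator_pos_of_cone (a := 3 / 2) (b := 7 / 4) (fun u v hu hv => by
        unfold dodecNumerator
        ring_nf
        positivity) h hs
  rcases lt_or_ge s (15 / 8) with hs | h
  · exact dodecNumerator_pos_of_cone (a := 7 / 4) (b := 15 / 8) (fun u v hu hv => by
        unfold dodecNumerator
        ring_nf
        positivity) h hs
  rcases lt_or_ge s (31 / 16) with hs | h
  · exact dodecNumerator_pos_of_cone (a := 15 / 8) (b := 31 / 16) (fun u v hu hv => by
        unfold dodecNumerator
        ring_nf
        positivity) h hs
  exact dodecNumerator_pos_of_cone (a := 31 / 16) (b := 2) (fun u v hu hv => by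
      unfold dodecNumerator
      ring_nf
      positivity) h h2

/-- The coefficients of the Laurent polynomial `dodecV` in even powers of `r`, from `r⁻⁴` up. -/
noncomputable def dodecCoeff : Fin 11 → ℝ :=
  ![8192/19683, -59392/19683, 806624/19683, -13240/243, 24908/729, -3371/243,
    8287/1944, -289/288, 47/288, -1/64, 1/1536]

theorem dodecV_eq_sum {r : ℝ} (hr : r ≠ 0) :
    dodecV r = ∑ i : Fin 11, dodecCoeff i * r ^ (2 * (i : ℤ) - 4) := by
  simp only [dodecV, dodecW, dodecCoeff, Fin.sum_univ_succ, Fin.sum_univ_zero]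
  norm_num [Fin.succ, zpow_neg]
  field_simp
  ring

theorem hasDerivAt_sum_zpow {n : ℕ} (c : Fin n → ℝ) (m : Fin n → ℤ) {r : ℝ} (hr : r ≠ 0) :
    HasDerivAt (fun x => ∑ i, c i * x ^ m i) (∑ i, c i * m i * r ^ (m i - 1)) r := by
  simp only [mul_assoc]
  exact HasDerivAt.fun_sum fun i _ => (hasDerivAt_zpow (m i) r (Or.inl hr)).const_mul (c i)

theorem hasDerivAt_dodecV {r : ℝ} (hr : r ≠ 0) :
    HasDerivAt dodecV
      (∑ i : Fin 11, dodecCoeff i * (2 * (i : ℤ) - 4 : ℤ) * r ^ (2 * (i : ℤ) - 4 - 1)) r :=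
  (hasDerivAt_sum_zpow dodecCoeff (fun i => 2 * (i : ℤ) - 4) hr).congr_of_eventuallyEq <| by
    filter_upwards [isOpen_ne.mem_nhds hr] with x hx using dodecV_eq_sum hx

theorem dodecV_second_deriv_eq {r : ℝ} (hr : r ≠ 0) :
    ∑ i : Fin 11, dodecCoeff i * (2 * (i : ℤ) - 4 : ℤ) * (2 * (i : ℤ) - 4 - 1 : ℤ) *
      r ^ (2 * (i : ℤ) - 4 - 1 - 1) = 4 / (19683 * r ^ 6) * dodecNumerator 1 (r ^ 2 / 2) := by
  simp only [dodecNumerator, dodecCoeff, Fin.sum_univ_succ, Fin.sum_univ_zero]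
  norm_num [Fin.succ, zpow_neg]
  field_simp
  ring

theorem strictConvexOn_dodecV : StrictConvexOn ℝ (Set.Ioc 0 2) dodecV := by
  refine StrictMonoOn.strictConvexOn_of_deriv (convex_Ioc 0 2)
    (fun r hr => (hasDerivAt_dodecV hr.1.ne').continuousAt.continuousWithinAt) ?_
  rw [interior_Ioc]
  have hd := fun (r : ℝ) (hr : r ∈ Set.Ioo (0 : ℝ) 2) => hasDerivAt_sum_zpow
    (fun i : Fin 11 => dodecCoeff i * (2 * (i : ℤ) - 4 : ℤ)) (fun i => 2 * (i : ℤ) - 4 - 1)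
    hr.1.ne'
  refine StrictMonoOn.congr (strictMonoOn_of_deriv_pos (convex_Ioo 0 2)
    (fun r hr => (hd r hr).continuousAt.continuousWithinAt) fun r hr => ?_)
    fun r hr => (hasDerivAt_dodecV hr.1.ne').deriv.symm
  rw [interior_Ioo] at hr
  rw [(hd r hr).deriv, dodecV_second_deriv_eq hr.1.ne']
  have h0 := hr.1
  exact mul_pos (by positivity) (dodecNumerator_pos (by positivity) (by nlinarith [hr.2]))

theorem dodecV_two : dodecV 2 = 0 := by
  norm_num [dodecV, dodecW]

theorem dodecV_pos {r : ℝ} (hr : r ∈ Set.Ioo (0 : ℝ) 2) : 0 < dodecV r := by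
  have h : 0 < 1 + (1 - r ^ 2 / 2) := by nlinarith [hr.1, hr.2]
  unfold dodecV dodecW
  positivity

/-- The dodecahedron potential is strictly decreasing and strictly convex on `(0, 2]`. -/
theorem dodecV_strictAnti_strictConvex :
    StrictAntiOn dodecV (Set.Ioc 0 2) ∧ StrictConvexOn ℝ (Set.Ioc 0 2) dodecV := by
  refine ⟨fun x hx y hy hxy => ?_, strictConvexOn_dodecV⟩
  have hVx : 0 < dodecV x := dodecV_pos ⟨hx.1, hxy.trans_le hy.2⟩
  rcases hy.2.eq_or_lt with rfl | hy2
  · rwa [dodecV_two]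
  · have h2 : (2 : ℝ) ∈ Set.Ioc (0 : ℝ) 2 := by norm_num
    have hlt := strictConvexOn_dodecV.lt_on_openSegment hx h2 (hxy.trans hy2).ne
      (by rw [openSegment_eq_Ioo (hxy.trans hy2)]; exact ⟨hxy, hy2⟩)
    rwa [dodecV_two, max_eq_left hVx.le] at hlt
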